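/- With the posterior density of κ given y, τ proportional to κ^{a+α-1}(1-κ)^{y-a-1} L((1/τ²)(1/κ−1)) with a > 1, α > 0, sup L ≤ M and L ≥ c₀ on [t₀,∞): E(1−κ | y, τ) → 0 as τ → 0, uniformly over integers y with 0 ≤ y < a−1. -/

import Mathlib

open MeasureTheory Real Filter

open scoped Topology

/-- The integrand `(1 + s t)^(-p) t^(-r) L(t)` obtained from the posterior density through the
substitution `κ = 1 / (1 + s t)`. -/
noncomputable def slopeKernel (L : ℝ → ℝ) (p r s t : ℝ) : ℝ :=
  (1 + s * t) ^ (-p) * t ^ (-r) * L t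

lemma measurable_slopeKernel {L : ℝ → ℝ} (hL : Measurable L) (p r s : ℝ) :
    Measurable (slopeKernel L p r s) := by
  unfold slopeKernel
  fun_prop

lemma abs_slopeKernel_le {L : ℝ → ℝ} {p s t : ℝ} (r : ℝ) (hp : 0 ≤ p) (hs : 0 ≤ s) (ht : 0 < t) :
    |slopeKernel L p r s t| ≤ |t ^ (-r) * L t| := by
  unfold slopeKernel
  rw [mul_assoc, abs_mul]
  have h1 : (1 + s * t) ^ (-p) ≤ 1 :=
    rpow_le_one_of_one_le_of_nonpos (by nlinarith [mul_nonneg hs ht.le]) (by linarith)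
  have h0 : 0 ≤ (1 + s * t) ^ (-p) := by positivity
  rw [abs_of_nonneg h0]
  exact mul_le_of_le_one_left (abs_nonneg _) h1

lemma integrableOn_slopeKernel_of_integrableOn {L : ℝ → ℝ} (hL : Measurable L) {p r s : ℝ}
    (hp : 0 ≤ p) (hs : 0 ≤ s) {S : Set ℝ} (hSm : MeasurableSet S) (hS : S ⊆ Set.Ioi 0)
    (h : IntegrableOn (fun t => t ^ (-r) * L t) S) :
    IntegrableOn (slopeKernel L p r s) S := by
  refine Integrable.mono h (measurable_slopeKernel hL p r s).aestronglyMeasurable ?_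
  filter_upwards [ae_restrict_mem hSm] with t ht
  exact abs_slopeKernel_le r hp hs (hS ht)

lemma integrableOn_Ioi_rpow_mul {L : ℝ → ℝ} (hL : Measurable L) {t₀ M r : ℝ} (ht₀ : 0 < t₀)
    (hb : ∀ t ≥ t₀, |L t| ≤ M) (hr : 1 < r) :
    IntegrableOn (fun t => t ^ (-r) * L t) (Set.Ioi t₀) := by
  have h := (integrableOn_Ioi_rpow_of_lt (show -r < -1 by linarith) ht₀).mul_const M
  refine Integrable.mono' h (by fun_prop) ?_
  filter_upwards [ae_restrict_mem measurableSet_Ioi] with t ht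
  have ht' : 0 < t := ht₀.trans ht
  rw [Real.norm_eq_abs, abs_mul, abs_of_pos (rpow_pos_of_pos ht' _)]
  exact mul_le_mul_of_nonneg_left (hb t (le_of_lt ht)) (by positivity)

lemma integrableOn_Ioi_slopeKernel {L : ℝ → ℝ} (hL : Measurable L) {t₀ M p r s : ℝ} (ht₀ : 0 < t₀)
    (hb : ∀ t ≥ t₀, |L t| ≤ M) (hp : 0 ≤ p) (hs : 0 < s) (hpr : 1 < p + r) :
    IntegrableOn (slopeKernel L p r s) (Set.Ioi t₀) := by
  have h := (integrableOn_Ioi_rpow_mul hL ht₀ hb hpr).const_mul (s ^ (-p))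
  refine Integrable.mono h (measurable_slopeKernel hL p r s).aestronglyMeasurable ?_
  filter_upwards [ae_restrict_mem measurableSet_Ioi] with t ht
  have ht' : 0 < t := ht₀.trans ht
  unfold slopeKernel
  have e : s ^ (-p) * (t ^ (-(p + r)) * L t) = (s * t) ^ (-p) * t ^ (-r) * L t := by
    rw [mul_rpow hs.le ht'.le, neg_add, rpow_add ht']; ring
  rw [e]
  simp only [norm_mul, Real.norm_eq_abs]
  gcongr ?_ * _ * _
  rw [abs_of_nonneg (by positivity), abs_of_nonneg (by positivity)]
  exact rpow_le_rpow_of_nonpos (by positivity) (by linarith) (by linarith)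

lemma integrableOn_slopeKernel {L : ℝ → ℝ} (hL : Measurable L) {t₀ M p r s : ℝ} (ht₀ : 0 < t₀)
    (hb : ∀ t ≥ t₀, |L t| ≤ M) (hp : 0 ≤ p) (hs : 0 < s) (hpr : 1 < p + r)
    (h0 : IntegrableOn (fun t => t ^ (-r) * L t) (Set.Ioc 0 t₀)) :
    IntegrableOn (slopeKernel L p r s) (Set.Ioi 0) := by
  rw [← Set.Ioc_union_Ioi_eq_Ioi ht₀.le]
  exact (integrableOn_slopeKernel_of_integrableOn hL hp hs.le measurableSet_Ioc
    Set.Ioc_subset_Ioi_self h0).union (integrableOn_Ioi_slopeKernel hL ht₀ hb hp hs hpr)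

lemma integrableOn_Ioc_of_integrableOn_slopeKernel {L : ℝ → ℝ} (hL : Measurable L)
    {t₀ p r s : ℝ} (hp : 0 ≤ p) (hs : 0 ≤ s)
    (h : IntegrableOn (slopeKernel L p r s) (Set.Ioi 0)) :
    IntegrableOn (fun t => t ^ (-r) * L t) (Set.Ioc 0 t₀) := by
  have h' := (h.mono_set (Set.Ioc_subset_Ioi_self : Set.Ioc 0 t₀ ⊆ _)).const_mul ((1 + s * t₀) ^ p)
  refine Integrable.mono h' (by fun_prop) ?_
  filter_upwards [ae_restrict_mem measurableSet_Ioc] with t ht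
  have ht' : 0 < t := ht.1
  have h1 : 0 < 1 + s * t := by positivity
  have h2 : 1 + s * t ≤ 1 + s * t₀ := by nlinarith [ht.2]
  unfold slopeKernel
  rw [mul_assoc, ← mul_assoc, norm_mul (_ * _)]
  refine le_mul_of_one_le_left (norm_nonneg _) ?_
  rw [Real.norm_eq_abs]
  refine le_trans ?_ (le_abs_self _)
  rw [rpow_neg h1.le, ← div_eq_mul_inv, one_le_div (by positivity)]
  exact rpow_le_rpow h1.le h2 hp

lemma integrableOn_Ioc_rpow_mul_sub_one {L : ℝ → ℝ} (hL : Measurable L) {t₀ r : ℝ}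
    (h0 : IntegrableOn (fun t => t ^ (-r) * L t) (Set.Ioc 0 t₀)) :
    IntegrableOn (fun t => t ^ (-(r - 1)) * L t) (Set.Ioc 0 t₀) := by
  refine Integrable.mono (h0.const_mul t₀) (by fun_prop) ?_
  filter_upwards [ae_restrict_mem measurableSet_Ioc] with t ht
  have ht' : 0 < t := ht.1
  have e : t ^ (-(r - 1)) = t * t ^ (-r) := by
    rw [show -(r - 1) = 1 + -r by ring, rpow_add ht', rpow_one]
  rw [e, mul_assoc, norm_mul, norm_mul t₀]
  gcongr
  rw [Real.norm_eq_abs, Real.norm_eq_abs, abs_of_pos ht']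
  exact ht.2.trans (le_abs_self _)

lemma continuousOn_integral_slopeKernel {L : ℝ → ℝ} (hL : Measurable L) {t₀ M p r : ℝ}
    (ht₀ : 0 < t₀) (hb : ∀ t ≥ t₀, |L t| ≤ M) (hp : 0 ≤ p) (hr : 1 < r)
    (h0 : IntegrableOn (fun t => t ^ (-r) * L t) (Set.Ioc 0 t₀)) :
    ContinuousOn (fun s => ∫ t in Set.Ioi 0, slopeKernel L p r s t) (Set.Ici 0) := by
  have hint : IntegrableOn (fun t => t ^ (-r) * L t) (Set.Ioi 0) := by
    rw [← Set.Ioc_union_Ioi_eq_Ioi ht₀.le]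
    exact h0.union (integrableOn_Ioi_rpow_mul hL ht₀ hb hr)
  refine continuousOn_of_dominated (bound := fun t => ‖t ^ (-r) * L t‖)
    (fun s _ => (measurable_slopeKernel hL p r s).aestronglyMeasurable) ?_ hint.norm ?_
  · intro s hs
    filter_upwards [ae_restrict_mem measurableSet_Ioi] with t ht
    exact abs_slopeKernel_le r hp hs ht
  · filter_upwards [ae_restrict_mem measurableSet_Ioi] with t ht s hs
    have ht' : (0 : ℝ) < t := ht
    have hs' : (0 : ℝ) ≤ s := hs
    have h1 : 1 + s * t ≠ 0 := by positivity
    apply ContinuousAt.continuousWithinAt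
    unfold slopeKernel
    refine ContinuousAt.mul (ContinuousAt.mul (ContinuousAt.rpow_const ?_ (Or.inl h1)) ?_) ?_ <;>
      fun_prop

lemma hasDerivAt_integral_slopeKernel {L : ℝ → ℝ} (hL : Measurable L) {t₀ M p r s : ℝ}
    (ht₀ : 0 < t₀) (hb : ∀ t ≥ t₀, |L t| ≤ M) (hp : 0 ≤ p) (hs : 0 < s) (hpr : 1 < p + r)
    (h0 : IntegrableOn (fun t => t ^ (-r) * L t) (Set.Ioc 0 t₀)) :
    HasDerivAt (fun s => ∫ t in Set.Ioi 0, slopeKernel L p r s t)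
      (-p * ∫ t in Set.Ioi 0, slopeKernel L (p + 1) (r - 1) s t) s := by
  have hint : IntegrableOn (slopeKernel L (p + 1) (r - 1) (s / 2)) (Set.Ioi 0) :=
    integrableOn_slopeKernel hL ht₀ hb (by linarith) (by linarith) (by linarith)
      (integrableOn_Ioc_rpow_mul_sub_one hL h0)
  rw [← integral_const_mul]
  refine (hasDerivAt_integral_of_dominated_loc_of_deriv_le (Ioi_mem_nhds (half_lt_self hs))
    (F' := fun s t => -p * slopeKernel L (p + 1) (r - 1) s t)
    (bound := fun t => p * ‖slopeKernel L (p + 1) (r - 1) (s / 2) t‖)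
    (Eventually.of_forall fun s => (measurable_slopeKernel hL p r s).aestronglyMeasurable)
    (integrableOn_slopeKernel hL ht₀ hb hp hs hpr h0)
    ((measurable_slopeKernel hL _ _ s).const_mul _).aestronglyMeasurable ?_
    (hint.norm.const_mul p) ?_).2
  · filter_upwards [ae_restrict_mem measurableSet_Ioi] with t ht x hx
    have ht' : (0 : ℝ) < t := ht
    have hx' : s / 2 < x := hx
    have hx0 : 0 < x := by linarith
    rw [norm_mul, norm_neg, Real.norm_of_nonneg hp]
    gcongr ?_ * ?_
    unfold slopeKernel
    simp only [norm_mul]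
    gcongr ?_ * _ * _
    rw [Real.norm_of_nonneg (by positivity), Real.norm_of_nonneg (by positivity)]
    exact rpow_le_rpow_of_nonpos (by positivity) (by gcongr) (by linarith)
  · filter_upwards [ae_restrict_mem measurableSet_Ioi] with t ht x hx
    have ht' : (0 : ℝ) < t := ht
    have hx' : s / 2 < x := hx
    have hx0 : 0 < x := by linarith
    have h1 : 1 + x * t ≠ 0 := by positivity
    have hd : HasDerivAt (fun x : ℝ => 1 + x * t) t x := by
      simpa using ((hasDerivAt_id x).mul_const t).const_add 1
    have h2 := ((hd.rpow_const (p := -p) (Or.inl h1)).mul_const (t ^ (-r))).mul_const (L t)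
    unfold slopeKernel
    refine h2.congr_deriv ?_
    rw [show -(r - 1) = 1 + -r by ring, rpow_add ht', rpow_one, show -(p + 1) = -p - 1 by ring]
    ring

lemma eventually_integral_slopeKernel_nonneg {L : ℝ → ℝ} (hL : Measurable L) {c₀ t₀ M p r : ℝ}
    (hc₀ : 0 < c₀) (ht₀ : 0 < t₀) (hlow : ∀ t ≥ t₀, c₀ ≤ L t) (hb : ∀ t ≥ t₀, |L t| ≤ M)
    (hp : 0 ≤ p) (hr : r ≤ 1) (hpr : 1 < p + r)
    (h0 : IntegrableOn (fun t => t ^ (-r) * L t) (Set.Ioc 0 t₀)) :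
    ∀ᶠ s in 𝓝[>] (0 : ℝ), 0 ≤ ∫ t in Set.Ioi 0, slopeKernel L p r s t := by
  set C := ∫ t in Set.Ioc 0 t₀, |t ^ (-r) * L t| with hC
  set T := max t₀ 1 with hT
  have hT0 : 0 < T := lt_max_of_lt_left ht₀
  have hlim : Tendsto (fun s : ℝ => (2 : ℝ) ^ (-p) * c₀ * log (s⁻¹ / T)) (𝓝[>] 0) atTop :=
    (tendsto_log_atTop.comp (tendsto_inv_nhdsGT_zero.atTop_div_const hT0)).const_mul_atTop
      (by positivity)
  filter_upwards [self_mem_nhdsWithin, hlim.eventually_ge_atTop C,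
    tendsto_inv_nhdsGT_zero.eventually_ge_atTop T] with s hs hsC hsT
  have hs' : (0 : ℝ) < s := hs
  have hsmall := integrableOn_slopeKernel_of_integrableOn hL hp hs'.le measurableSet_Ioc
    Set.Ioc_subset_Ioi_self h0
  have htail := integrableOn_Ioi_slopeKernel hL ht₀ hb hp hs' hpr
  rw [← Set.Ioc_union_Ioi_eq_Ioi ht₀.le, setIntegral_union (Set.Ioc_disjoint_Ioi le_rfl)
    measurableSet_Ioi hsmall htail]
  have h1 : -C ≤ ∫ t in Set.Ioc 0 t₀, slopeKernel L p r s t := by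
    rw [hC, ← integral_neg]
    refine setIntegral_mono_on h0.abs.neg hsmall measurableSet_Ioc fun t ht => ?_
    exact (abs_le.1 (abs_slopeKernel_le r hp hs'.le ht.1)).1
  have hsub : Set.Ioc T s⁻¹ ⊆ Set.Ioi t₀ := fun t ht => (le_max_left _ _).trans_lt ht.1
  have h2 : ∫ t in Set.Ioc T s⁻¹, slopeKernel L p r s t ≤
      ∫ t in Set.Ioi t₀, slopeKernel L p r s t := by
    refine setIntegral_mono_set htail ?_ hsub.eventuallyLE
    filter_upwards [ae_restrict_mem measurableSet_Ioi] with t ht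
    have ht' : 0 < t := ht₀.trans ht
    have := hc₀.le.trans (hlow t (le_of_lt ht))
    unfold slopeKernel
    simp only [Pi.zero_apply]
    positivity
  have h3 : (2 : ℝ) ^ (-p) * c₀ * log (s⁻¹ / T) ≤
      ∫ t in Set.Ioc T s⁻¹, slopeKernel L p r s t := by
    rw [← integral_inv_of_pos hT0 (inv_pos.2 hs'), intervalIntegral.integral_of_le hsT,
      ← integral_const_mul]
    have hinv : IntegrableOn (fun t : ℝ => t⁻¹) (Set.Ioc T s⁻¹) := by
      refine ContinuousOn.integrableOn_Icc ?_ |>.mono_set Set.Ioc_subset_Icc_self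
      exact continuousOn_inv₀.mono fun t ht => (hT0.trans_le ht.1).ne'
    refine setIntegral_mono_on (hinv.const_mul _) (htail.mono_set hsub) measurableSet_Ioc
      fun t ht => ?_
    have ht1 : 1 ≤ t := (le_max_right _ _).trans ht.1.le
    have ht' : 0 < t := by linarith
    have hst : s * t ≤ 1 := by
      have := mul_le_mul_of_nonneg_left ht.2 hs'.le
      rwa [mul_inv_cancel₀ hs'.ne'] at this
    have e1 : (2 : ℝ) ^ (-p) ≤ (1 + s * t) ^ (-p) :=
      rpow_le_rpow_of_nonpos (by positivity) (by linarith) (by linarith)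
    have e2 : t⁻¹ ≤ t ^ (-r) := by
      rw [← rpow_neg_one]
      exact rpow_le_rpow_of_exponent_le ht1 (by linarith)
    unfold slopeKernel
    calc (2 : ℝ) ^ (-p) * c₀ * t⁻¹ = 2 ^ (-p) * t⁻¹ * c₀ := by ring
      _ ≤ (1 + s * t) ^ (-p) * t ^ (-r) * L t := by
        gcongr
        exact hlow t (hsub ht).le
  linarith

/-- If the integral vanishes at `s = 0`, then near `0⁺` its sign is opposite to an eventual sign of
its derivative's kernel. -/
lemma sign_integral_slopeKernel_of_deriv {L : ℝ → ℝ} (hL : Measurable L) {t₀ M p r σ : ℝ}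
    (ht₀ : 0 < t₀) (hb : ∀ t ≥ t₀, |L t| ≤ M) (hp : 0 ≤ p) (hr : 1 < r)
    (h0 : IntegrableOn (fun t => t ^ (-r) * L t) (Set.Ioc 0 t₀))
    (hz : ∫ t in Set.Ioi 0, slopeKernel L p r 0 t = 0)
    (hσ : ∀ᶠ s in 𝓝[>] (0 : ℝ), 0 ≤ σ * ∫ t in Set.Ioi 0, slopeKernel L (p + 1) (r - 1) s t) :
    ∀ᶠ s in 𝓝[>] (0 : ℝ), σ * ∫ t in Set.Ioi 0, slopeKernel L p r s t ≤ 0 := by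
  obtain ⟨δ, hδ, hsub⟩ := mem_nhdsGT_iff_exists_Ioo_subset.1 hσ
  have hδ' : (0 : ℝ) < δ := hδ
  have hanti : AntitoneOn (fun s => σ * ∫ t in Set.Ioi 0, slopeKernel L p r s t)
      (Set.Ico 0 δ) := by
    refine antitoneOn_of_hasDerivWithinAt_nonpos (convex_Ico 0 δ)
      (f' := fun s => σ * (-p * ∫ t in Set.Ioi 0, slopeKernel L (p + 1) (r - 1) s t))
      (((continuousOn_integral_slopeKernel hL ht₀ hb hp hr h0).mono
        Set.Ico_subset_Ici_self).const_mul σ) ?_ ?_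
    · intro s hs
      rw [interior_Ico] at hs
      exact ((hasDerivAt_integral_slopeKernel hL ht₀ hb hp hs.1 (by linarith)
        h0).const_mul σ).hasDerivWithinAt
    · intro s hs
      rw [interior_Ico] at hs
      have h1 : 0 ≤ σ * ∫ t in Set.Ioi 0, slopeKernel L (p + 1) (r - 1) s t := hsub hs
      nlinarith [mul_nonneg hp h1]
  filter_upwards [Ioo_mem_nhdsGT hδ'] with s hs
  have := hanti ⟨le_rfl, hδ'⟩ ⟨hs.1.le, hs.2⟩ hs.1.le
  simpa [hz] using this

/-- The integral has an eventually constant weak sign as `s → 0⁺`. -/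
lemma exists_eventual_sign_integral_slopeKernel {L : ℝ → ℝ} (hL : Measurable L) {c₀ t₀ M : ℝ}
    (hc₀ : 0 < c₀) (ht₀ : 0 < t₀) (hlow : ∀ t ≥ t₀, c₀ ≤ L t) (hb : ∀ t ≥ t₀, |L t| ≤ M)
    (n : ℕ) {p r : ℝ} (hn : r ≤ n + 1) (hp : 0 ≤ p) (hpr : 1 < p + r)
    (h0 : IntegrableOn (fun t => t ^ (-r) * L t) (Set.Ioc 0 t₀)) :
    ∃ σ : ℝ, σ ≠ 0 ∧
      ∀ᶠ s in 𝓝[>] (0 : ℝ), 0 ≤ σ * ∫ t in Set.Ioi 0, slopeKernel L p r s t := by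
  induction n generalizing p r with
  | zero =>
    refine ⟨1, one_ne_zero, ?_⟩
    simpa using eventually_integral_slopeKernel_nonneg hL hc₀ ht₀ hlow hb hp
      (by simpa using hn) hpr h0
  | succ n ih =>
    by_cases hr : r ≤ 1
    · refine ⟨1, one_ne_zero, ?_⟩
      simpa using eventually_integral_slopeKernel_nonneg hL hc₀ ht₀ hlow hb hp hr hpr h0
    have hr := not_le.1 hr
    by_cases hz : ∫ t in Set.Ioi 0, slopeKernel L p r 0 t = 0
    · obtain ⟨σ, hσ0, hσ⟩ := ih (p := p + 1) (r := r - 1) (by push_cast at hn; linarith)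
        (by linarith) (by linarith) (integrableOn_Ioc_rpow_mul_sub_one hL h0)
      refine ⟨-σ, neg_ne_zero.2 hσ0, ?_⟩
      filter_upwards [sign_integral_slopeKernel_of_deriv hL ht₀ hb hp hr h0 hz hσ] with s hs
      linarith
    · refine ⟨_, hz, ?_⟩
      have hc := ((continuousOn_integral_slopeKernel hL ht₀ hb hp hr h0) 0
        Set.self_mem_Ici).mono_left (nhdsWithin_mono 0 Set.Ioi_subset_Ici_self)
      exact ((hc.const_mul _).eventually_const_lt (mul_self_pos.2 hz)).mono fun s hs => hs.le

lemma eventually_slopeKernel_ratio_le {L : ℝ → ℝ} (hL : Measurable L) {c₀ t₀ M p r ε : ℝ}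
    (hc₀ : 0 < c₀) (ht₀ : 0 < t₀) (hlow : ∀ t ≥ t₀, c₀ ≤ L t) (hb : ∀ t ≥ t₀, |L t| ≤ M)
    (hp : 0 ≤ p) (hr : 2 < r) (hε : 0 < ε) :
    ∀ᶠ s in 𝓝[>] (0 : ℝ), s * (∫ t in Set.Ioi 0, slopeKernel L (p + 1) (r - 1) s t) /
      (∫ t in Set.Ioi 0, slopeKernel L p r s t) ≤ ε := by
  by_cases h0 : IntegrableOn (fun t => t ^ (-r) * L t) (Set.Ioc 0 t₀)
  swap
  · filter_upwards [self_mem_nhdsWithin] with s hs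
    rw [integral_undef fun h => h0
      (integrableOn_Ioc_of_integrableOn_slopeKernel hL hp (le_of_lt hs) h), div_zero]
    exact hε.le
  have h1 := integrableOn_Ioc_rpow_mul_sub_one hL h0
  by_cases hz : ∫ t in Set.Ioi 0, slopeKernel L p r 0 t = 0
  · obtain ⟨n, hn⟩ := exists_nat_ge (r - 1)
    obtain ⟨σ, hσ0, hσ⟩ := exists_eventual_sign_integral_slopeKernel hL hc₀ ht₀ hlow hb n
      (p := p + 1) (r := r - 1) (by linarith) (by linarith) (by linarith) h1
    filter_upwards [self_mem_nhdsWithin, hσ, sign_integral_slopeKernel_of_deriv hL ht₀ hb hp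
      (by linarith) h0 hz hσ] with s hs hG hF
    have hs' : (0 : ℝ) < s := hs
    refine le_trans ?_ hε.le
    rw [← mul_div_mul_left _ _ hσ0, mul_left_comm]
    exact div_nonpos_of_nonneg_of_nonpos (mul_nonneg hs'.le hG) hF
  · have hF := ((continuousOn_integral_slopeKernel hL ht₀ hb hp (by linarith) h0) 0
        Set.self_mem_Ici).mono_left (nhdsWithin_mono 0 Set.Ioi_subset_Ici_self)
    have hG := ((continuousOn_integral_slopeKernel hL ht₀ hb (p := p + 1) (r := r - 1)
        (by linarith) (by linarith) h1) 0
        Set.self_mem_Ici).mono_left (nhdsWithin_mono 0 Set.Ioi_subset_Ici_self)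
    have hid : Tendsto (fun s : ℝ => s) (𝓝[>] 0) (𝓝 0) := nhdsWithin_le_nhds
    have := (hid.mul hG).div hF hz
    rw [zero_mul, zero_div] at this
    exact (this.eventually_lt_const hε).mono fun s hs => hs.le

/-- The substitution `u = 1 / (1 + s t)`. -/
lemma integral_Ioo_eq_integral_slopeKernel (L : ℝ → ℝ) (b e : ℝ) {s : ℝ} (hs : 0 < s) :
    ∫ u in Set.Ioo (0 : ℝ) 1, u ^ b * (1 - u) ^ e * L ((1 / s) * (1 / u - 1)) =
      s ^ (e + 1) * ∫ t in Set.Ioi 0, slopeKernel L (b + e + 2) (-e) s t := by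
  have himg : (fun t : ℝ => (1 + s * t)⁻¹) '' Set.Ioi 0 = Set.Ioo 0 1 := by
    ext u
    constructor
    · rintro ⟨t, ht, rfl⟩
      have ht' : (0 : ℝ) < t := ht
      exact ⟨by positivity, inv_lt_one_of_one_lt₀ (by nlinarith [mul_pos hs ht'])⟩
    · rintro ⟨hu0, hu1⟩
      refine ⟨(1 / s) * (1 / u - 1), ?_, ?_⟩
      · have : 1 < 1 / u := by rwa [lt_div_iff₀ hu0, one_mul]
        exact mul_pos (one_div_pos.2 hs) (sub_pos.2 this)
      · field_simp
        ring
  have hinj : Set.InjOn (fun t : ℝ => (1 + s * t)⁻¹) (Set.Ioi 0) := fun x _ y _ hxy => by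
    have := inv_injective hxy
    exact mul_left_cancel₀ hs.ne' (add_left_cancel this)
  have hderiv : ∀ t ∈ Set.Ioi (0 : ℝ), HasDerivWithinAt (fun t : ℝ => (1 + s * t)⁻¹)
      (-s / (1 + s * t) ^ 2) (Set.Ioi 0) t := fun t ht => by
    have ht' : (0 : ℝ) < t := ht
    have hd : HasDerivAt (fun x : ℝ => 1 + s * x) s t := by
      simpa using ((hasDerivAt_id t).const_mul s).const_add 1
    exact (hd.fun_inv (by positivity)).hasDerivWithinAt
  rw [← himg, integral_image_eq_integral_abs_deriv_smul measurableSet_Ioi hderiv hinj,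
    ← integral_const_mul]
  refine setIntegral_congr_fun measurableSet_Ioi fun t ht => ?_
  have ht' : (0 : ℝ) < t := ht
  have hw : 0 < 1 + s * t := by positivity
  have e1 : 1 - (1 + s * t)⁻¹ = s * t * (1 + s * t)⁻¹ := by field_simp; ring
  have e2 : (1 / s) * (1 / (1 + s * t)⁻¹ - 1) = t := by field_simp; ring
  have e3 : |-s / (1 + s * t) ^ 2| = s * (1 + s * t) ^ (-2 : ℝ) := by
    rw [abs_div, abs_neg, abs_of_pos hs, abs_of_pos (by positivity), rpow_neg hw.le, div_eq_mul_inv]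
    norm_cast
  simp only [smul_eq_mul, slopeKernel]
  rw [e1, e2, e3, mul_rpow (by positivity) (by positivity), mul_rpow hs.le ht'.le,
    ← rpow_neg_one (1 + s * t), ← rpow_mul hw.le, ← rpow_mul hw.le, neg_neg,
    show -(b + e + 2) = -1 * b + (-1 * e) + -2 by ring, rpow_add hw, rpow_add hw,
    rpow_add hs, rpow_one]
  ring

/-- E(1-κ|y,τ) → 0 as τ → 0⁺, uniformly over integers 0 ≤ y < a-1. -/
theorem stmt8 (L : ℝ → ℝ) (hmeas : Measurable L) (c₀ t₀ M : ℝ)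
    (hc₀ : 0 < c₀) (ht₀ : 0 < t₀) (hM : 0 < M)
    (hLlow : ∀ t ≥ t₀, c₀ ≤ L t) (hLup : ∀ t > (0:ℝ), L t ≤ M)
    (a α : ℝ) (ha : 1 < a) (hα : 0 < α) :
    ∀ ε > (0:ℝ), ∃ τ₀ > (0:ℝ), ∀ τ : ℝ, 0 < τ → τ < τ₀ →
      ∀ y : ℕ, (y:ℝ) < a - 1 →
        (∫ u in Set.Ioo (0:ℝ) 1,
            u ^ (a + α - 1) * (1 - u) ^ ((y:ℝ) - a) * L ((1 / τ ^ 2) * (1 / u - 1))) /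
          (∫ u in Set.Ioo (0:ℝ) 1,
            u ^ (a + α - 1) * (1 - u) ^ ((y:ℝ) - a - 1) * L ((1 / τ ^ 2) * (1 / u - 1))) ≤ ε := by
  intro ε hε
  have hb : ∀ t ≥ t₀, |L t| ≤ M := fun t ht => by
    rw [abs_of_nonneg (hc₀.le.trans (hLlow t ht))]
    exact hLup t (ht₀.trans_le ht)
  have hfin : {y : ℕ | (y : ℝ) < a - 1}.Finite :=
    (Set.finite_lt_nat ⌈a - 1⌉₊).subset fun y hy => Nat.lt_ceil.2 hy
  have hev := (eventually_all_finite hfin).2 fun y (hy : (y : ℝ) < a - 1) =>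
    eventually_slopeKernel_ratio_le hmeas (p := α + y) (r := a + 1 - y) hc₀ ht₀ hLlow hb
      (by positivity) (by linarith) hε
  obtain ⟨δ, hδ, hsub⟩ := mem_nhdsGT_iff_exists_Ioo_subset.1 hev
  have hδ' : (0 : ℝ) < δ := hδ
  refine ⟨√δ, sqrt_pos.2 hδ', fun τ hτ hτδ y hy => ?_⟩
  have hs : 0 < τ ^ 2 := by positivity
  have key := hsub ⟨hs, (lt_sqrt hτ.le).1 hτδ⟩ y hy
  rw [integral_Ioo_eq_integral_slopeKernel L _ _ hs, integral_Ioo_eq_integral_slopeKernel L _ _ hs]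
  convert key using 1
  rw [show a + α - 1 + (y - a) + 2 = α + y + 1 by ring, show -((y : ℝ) - a) = a + 1 - y - 1 by ring,
    show a + α - 1 + (y - a - 1) + 2 = α + y by ring, show -((y : ℝ) - a - 1) = a + 1 - y by ring,
    show (y : ℝ) - a - 1 + 1 = y - a by ring, rpow_add hs, rpow_one, mul_assoc,
    mul_div_mul_left _ _ (by positivity)]
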